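/- arXiv:2406.01343 — 2 statements merged into one kernel-verified Lean document; each statement's English description precedes it below -/
import Mathlib

section
/- Let K ⊆ ℝ be convex and T : B₀(Σ,K) → ℝ̄ a map. If T is quasiconvex, then both the lower semicontinuous envelope T⁻ and the upper semicontinuous envelope T⁺ are quasiconvex; if T is quasiconcave, then both T⁻ and T⁺ are quasiconcave. -/
variable {S : Type*} [MeasurableSpace S]

/-- `B₀(Σ,K)`: the set of Σ-measurable simple (finite-range) functions `φ : S → ℝ`
with values in `K`. -/
def B0 (K : Set ℝ) : Set (S → ℝ) :=
  {φ | Measurable φ ∧ (Set.range φ).Finite ∧ Set.range φ ⊆ K}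

/-- The lower semicontinuous envelope of `T` on `B₀(Σ,K)` (sup-norm topology):
`T⁻(φ) = sup` over sup-norm balls around `φ` of the infimum of `T` over the ball. -/
noncomputable def lscEnv (K : Set ℝ) (T : (S → ℝ) → EReal) (φ : S → ℝ) : EReal :=
  ⨆ δ : {d : ℝ // 0 < d},
    ⨅ ψ : {ψ : S → ℝ // ψ ∈ B0 (S := S) K ∧ ∀ s, |ψ s - φ s| ≤ δ.1}, T ψ.1

/-- The upper semicontinuous envelope of `T` on `B₀(Σ,K)` (sup-norm topology):
`T⁺(φ) = inf` over sup-norm balls around `φ` of the supremum of `T` over the ball. -/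
noncomputable def uscEnv (K : Set ℝ) (T : (S → ℝ) → EReal) (φ : S → ℝ) : EReal :=
  ⨅ δ : {d : ℝ // 0 < d},
    ⨆ ψ : {ψ : S → ℝ // ψ ∈ B0 (S := S) K ∧ ∀ s, |ψ s - φ s| ≤ δ.1}, T ψ.1

/-- `T` is quasiconvex on `B₀(Σ,K)`. -/
def EQuasiconvexOnB0 (K : Set ℝ) (T : (S → ℝ) → EReal) : Prop :=
  ∀ α : ℝ, α ∈ Set.Icc (0 : ℝ) 1 → ∀ φ : S → ℝ, φ ∈ B0 K → ∀ ψ : S → ℝ, ψ ∈ B0 K →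
    T (fun s => α * φ s + (1 - α) * ψ s) ≤ max (T φ) (T ψ)

/-- `T` is quasiconcave on `B₀(Σ,K)`. -/
def EQuasiconcaveOnB0 (K : Set ℝ) (T : (S → ℝ) → EReal) : Prop :=
  ∀ α : ℝ, α ∈ Set.Icc (0 : ℝ) 1 → ∀ φ : S → ℝ, φ ∈ B0 K → ∀ ψ : S → ℝ, ψ ∈ B0 K →
    min (T φ) (T ψ) ≤ T (fun s => α * φ s + (1 - α) * ψ s)

/-- Any pointwise function of three simple functions is simple. -/
theorem comp₃_mem_B0 {K : Set ℝ} {φ ψ ξ : S → ℝ} (hφ : φ ∈ B0 K) (hψ : ψ ∈ B0 K)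
    (hξ : ξ ∈ B0 K) (F : ℝ → ℝ → ℝ → ℝ) (hF : ∀ s, F (φ s) (ψ s) (ξ s) ∈ K) :
    (fun s => F (φ s) (ψ s) (ξ s)) ∈ B0 (S := S) K := by
  have simple : ∀ {η : S → ℝ}, η ∈ B0 K → ∃ f : MeasureTheory.SimpleFunc S ℝ, ⇑f = η :=
    fun {η} h => ⟨⟨η, fun x => h.1 (measurableSet_singleton x), h.2.1⟩, rfl⟩
  obtain ⟨f, rfl⟩ := simple hφ
  obtain ⟨g, rfl⟩ := simple hψ
  obtain ⟨h, rfl⟩ := simple hξ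
  let k := ((f.pair g).pair h).map fun p => F p.1.1 p.1.2 p.2
  exact ⟨k.measurable, k.finite_range, Set.range_subset_iff.2 hF⟩

theorem convexCombination_mem_B0 {K : Set ℝ} (hK : Convex ℝ K) {α : ℝ}
    (hα : α ∈ Set.Icc (0 : ℝ) 1) {φ ψ : S → ℝ} (hφ : φ ∈ B0 K) (hψ : ψ ∈ B0 K) :
    (fun s => α * φ s + (1 - α) * ψ s) ∈ B0 (S := S) K :=
  comp₃_mem_B0 hφ hψ hψ (fun a b _ => α * a + (1 - α) * b) fun s =>
    hK (hφ.2.2 ⟨s, rfl⟩) (hψ.2.2 ⟨s, rfl⟩) hα.1 (by linarith [hα.2]) (by ring)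

theorem exists_decomposition_of_le {K : Set ℝ} (hK : Convex ℝ K) {α β r a b x : ℝ}
    (hα : 0 < α) (hβ : 0 < β) (hαβ : α + β = 1) (ha : a ∈ K) (hb : b ∈ K) (hx : x ∈ K)
    (hab : a ≤ b) (h₁ : |x - (α * a + β * b)| ≤ α * r) (h₂ : |x - (α * a + β * b)| ≤ β * r) :
    ∃ a' ∈ K, ∃ b' ∈ K, α * a' + β * b' = x ∧ |a' - a| ≤ r ∧ |b' - b| ≤ r := by
  obtain rfl : β = 1 - α := by linarith
  rw [abs_le] at h₁ h₂
  have hr : 0 ≤ r := by nlinarith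
  have hOrd := hK.ordConnected
  rcases le_or_gt b x with hbx | hxb
  · refine ⟨x, hx, x, hx, by ring, ?_, ?_⟩ <;> rw [abs_le] <;> constructor <;> nlinarith
  rcases le_or_gt x a with hxa | hax
  · refine ⟨x, hx, x, hx, by ring, ?_, ?_⟩ <;> rw [abs_le] <;> constructor <;> nlinarith
  rcases le_total (α * a + (1 - α) * b) x with hm | hm
  · obtain ⟨a', ha'⟩ : ∃ a', α * a' = x - (1 - α) * b :=
      ⟨(x - (1 - α) * b) / α, by field_simp⟩
    refine ⟨a', hOrd.out ha hb ⟨?_, ?_⟩, b, hb, by linarith, ?_, by simpa⟩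
    · exact le_of_mul_le_mul_left (by linarith) hα
    · exact le_of_mul_le_mul_left (by linarith) hα
    · rw [abs_le]
      constructor <;> refine le_of_mul_le_mul_left ?_ hα <;> linarith
  · obtain ⟨b', hb'⟩ : ∃ b', (1 - α) * b' = x - α * a :=
      ⟨(x - α * a) / (1 - α), by field_simp⟩
    refine ⟨a, ha, b', hOrd.out ha hb ⟨?_, ?_⟩, by linarith, by simpa, ?_⟩
    · exact le_of_mul_le_mul_left (by linarith) hβ
    · exact le_of_mul_le_mul_left (by linarith) hβ
    · rw [abs_le]
      constructor <;> refine le_of_mul_le_mul_left ?_ hβ <;> linarith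

/-- A point of a convex set close to a convex combination of `a` and `b` is the same
combination of points of the set close to `a` and `b`. -/
theorem exists_decomposition {K : Set ℝ} (hK : Convex ℝ K) {α β r a b x : ℝ}
    (hα : 0 < α) (hβ : 0 < β) (hαβ : α + β = 1) (ha : a ∈ K) (hb : b ∈ K) (hx : x ∈ K)
    (h₁ : |x - (α * a + β * b)| ≤ α * r) (h₂ : |x - (α * a + β * b)| ≤ β * r) :
    ∃ a' ∈ K, ∃ b' ∈ K, α * a' + β * b' = x ∧ |a' - a| ≤ r ∧ |b' - b| ≤ r := by
  rcases le_total a b with hab | hba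
  · exact exists_decomposition_of_le hK hα hβ hαβ ha hb hx hab h₁ h₂
  · rw [add_comm (α * a)] at h₁ h₂
    obtain ⟨b', hb', a', ha', h, hb'', ha''⟩ :=
      exists_decomposition_of_le hK hβ hα (by linarith) hb ha hx hba h₂ h₁
    exact ⟨a', ha', b', hb', by linarith, ha'', hb''⟩

theorem EQuasiconvexOnB0.lscEnv {K : Set ℝ} (hK : Convex ℝ K) {T : (S → ℝ) → EReal}
    (hT : EQuasiconvexOnB0 K T) : EQuasiconvexOnB0 K (lscEnv K T) := by
  intro α hα φ _ ψ _
  refine iSup_le fun δ => ?_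
  refine le_trans ?_ (max_le_max (le_iSup _ δ) (le_iSup _ δ))
  refine le_of_forall_gt fun c hc => ?_
  obtain ⟨h₁, h₂⟩ := max_lt_iff.1 hc
  obtain ⟨⟨φ', hφ', dφ⟩, h₁⟩ := iInf_lt_iff.1 h₁
  obtain ⟨⟨ψ', hψ', dψ⟩, h₂⟩ := iInf_lt_iff.1 h₂
  refine iInf_lt_iff.2 ⟨⟨_, convexCombination_mem_B0 hK hα hφ' hψ', fun s => ?_⟩,
    (hT α hα φ' hφ' ψ' hψ').trans_lt (max_lt h₁ h₂)⟩
  have h₁ := abs_le.1 (dφ s)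
  have h₂ := abs_le.1 (dψ s)
  obtain ⟨h0, h1⟩ := hα
  rw [abs_le]
  constructor <;> nlinarith

theorem EQuasiconvexOnB0.uscEnv {K : Set ℝ} (hK : Convex ℝ K) {T : (S → ℝ) → EReal}
    (hT : EQuasiconvexOnB0 K T) : EQuasiconvexOnB0 K (uscEnv K T) := by
  intro α hα φ hφ ψ hψ
  rcases hα.1.eq_or_lt with rfl | h0
  · simp
  rcases hα.2.eq_or_lt with rfl | h1
  · simp
  have h1' : 0 < 1 - α := by linarith
  refine le_of_forall_gt fun c hc => ?_
  obtain ⟨h₁, h₂⟩ := max_lt_iff.1 hc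
  obtain ⟨⟨δ₁, hδ₁⟩, h₁⟩ := iInf_lt_iff.1 h₁
  obtain ⟨⟨δ₂, hδ₂⟩, h₂⟩ := iInf_lt_iff.1 h₂
  have hr : 0 < min δ₁ δ₂ := lt_min hδ₁ hδ₂
  have hδ : 0 < min α (1 - α) * min δ₁ δ₂ := mul_pos (lt_min h0 h1') hr
  refine (iInf_le _ ⟨_, hδ⟩).trans_lt (lt_of_le_of_lt (iSup_le ?_) (max_lt h₁ h₂))
  rintro ⟨ξ, hξ, dξ⟩
  have key : ∀ a b x : ℝ, ∃ a' b' : ℝ, a ∈ K → b ∈ K → x ∈ K →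
      |x - (α * a + (1 - α) * b)| ≤ min α (1 - α) * min δ₁ δ₂ →
      a' ∈ K ∧ b' ∈ K ∧ α * a' + (1 - α) * b' = x ∧
        |a' - a| ≤ min δ₁ δ₂ ∧ |b' - b| ≤ min δ₁ δ₂ := by
    intro a b x
    by_cases h : a ∈ K ∧ b ∈ K ∧ x ∈ K ∧
        |x - (α * a + (1 - α) * b)| ≤ min α (1 - α) * min δ₁ δ₂
    · obtain ⟨ha, hb, hx, hd⟩ := h
      obtain ⟨a', ha', b', hb', h⟩ := exists_decomposition hK h0 h1' (by ring) ha hb hx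
        (hd.trans (mul_le_mul_of_nonneg_right (min_le_left _ _) hr.le))
        (hd.trans (mul_le_mul_of_nonneg_right (min_le_right _ _) hr.le))
      exact ⟨a', b', fun _ _ _ _ => ⟨ha', hb', h⟩⟩
    · exact ⟨0, 0, fun ha hb hx hd => (h ⟨ha, hb, hx, hd⟩).elim⟩
  choose F G hFG using key
  have hs := fun s => hFG (φ s) (ψ s) (ξ s) (hφ.2.2 ⟨s, rfl⟩) (hψ.2.2 ⟨s, rfl⟩)
    (hξ.2.2 ⟨s, rfl⟩) (dξ s)
  have hφ' := comp₃_mem_B0 hφ hψ hξ F fun s => (hs s).1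
  have hψ' := comp₃_mem_B0 hφ hψ hξ G fun s => (hs s).2.1
  have hT' := hT α hα _ hφ' _ hψ'
  rw [funext fun s => (hs s).2.2.1] at hT'
  refine hT'.trans (max_le_max ?_ ?_)
  · exact le_iSup (fun η : {η : S → ℝ // η ∈ B0 K ∧ ∀ s, |η s - φ s| ≤ δ₁} => T η.1)
      ⟨_, hφ', fun s => (hs s).2.2.2.1.trans (min_le_left _ _)⟩
  · exact le_iSup (fun η : {η : S → ℝ // η ∈ B0 K ∧ ∀ s, |η s - ψ s| ≤ δ₂} => T η.1)
      ⟨_, hψ', fun s => (hs s).2.2.2.2.trans (min_le_right _ _)⟩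

theorem EReal.neg_iSup_eq {ι : Sort*} (f : ι → EReal) : -(⨆ i, f i) = ⨅ i, -f i :=
  EReal.negOrderIso.map_iSup f

theorem EReal.neg_iInf_eq {ι : Sort*} (f : ι → EReal) : -(⨅ i, f i) = ⨆ i, -f i :=
  EReal.negOrderIso.map_iInf f

theorem lscEnv_neg (K : Set ℝ) (T : (S → ℝ) → EReal) :
    lscEnv K (fun φ => -T φ) = fun φ => -uscEnv K T φ := by
  funext φ
  simp only [lscEnv, uscEnv, EReal.neg_iSup_eq, EReal.neg_iInf_eq]

theorem uscEnv_neg (K : Set ℝ) (T : (S → ℝ) → EReal) :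
    uscEnv K (fun φ => -T φ) = fun φ => -lscEnv K T φ := by
  funext φ
  simp only [lscEnv, uscEnv, EReal.neg_iSup_eq, EReal.neg_iInf_eq]

theorem eQuasiconvexOnB0_neg {K : Set ℝ} {T : (S → ℝ) → EReal} :
    EQuasiconvexOnB0 K (fun φ => -T φ) ↔ EQuasiconcaveOnB0 K T := by
  simp only [EQuasiconvexOnB0, EQuasiconcaveOnB0, le_max_iff, min_le_iff, EReal.neg_le_neg_iff]

/-- for a convex `K ⊆ ℝ` and `T : B₀(Σ,K) → ℝ̄`, if `T` is quasiconvex then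
`T⁻` and `T⁺` are quasiconvex, and if `T` is quasiconcave then `T⁻` and `T⁺` are
quasiconcave. -/
theorem stmt_9 (K : Set ℝ) (hK : Convex ℝ K) (T : (S → ℝ) → EReal) :
    (EQuasiconvexOnB0 K T →
      EQuasiconvexOnB0 K (lscEnv K T) ∧ EQuasiconvexOnB0 K (uscEnv K T)) ∧
    (EQuasiconcaveOnB0 K T →
      EQuasiconcaveOnB0 K (lscEnv K T) ∧ EQuasiconcaveOnB0 K (uscEnv K T)) := by
  refine ⟨fun hT => ⟨hT.lscEnv hK, hT.uscEnv hK⟩, fun hT => ?_⟩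
  rw [← eQuasiconvexOnB0_neg] at hT
  rw [← eQuasiconvexOnB0_neg, ← eQuasiconvexOnB0_neg, ← lscEnv_neg, ← uscEnv_neg]
  exact ⟨hT.uscEnv hK, hT.lscEnv hK⟩
end

section
/- Let K ⊆ ℝ be convex and unbounded from above, let T : B₀(Σ,K) → ℝ̄ be constant superadditive, and let p be a probability measure on (S,Σ). Define G_T(t,p) = sup{ T(φ) : φ ∈ B₀(Σ,K) and ∫_S φ dp ≤ t } for t ∈ ℝ. Then the map t ↦ G_T(t,p) is constant superadditive: G_T(t+k, p) ≥ G_T(t,p) + k for every t ∈ ℝ and every k ≥ 0. -/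
open MeasureTheory

variable {S : Type*} [MeasurableSpace S]

/-- `G_T(t,p) = sup{ T(φ) : φ ∈ B₀(Σ,K), ∫ φ dp ≤ t }` (with `sup ∅ = −∞`). -/
noncomputable def GT (K : Set ℝ) (T : (S → ℝ) → EReal) (p : Measure S) (t : ℝ) : EReal :=
  sSup {y : EReal | ∃ φ ∈ B0 (S := S) K, (∫ s, φ s ∂p) ≤ t ∧ y = T φ}

/-- An extended-real-valued `T` is constant superadditive on `B₀(Σ,K)`. -/
def EConstSuperadd (K : Set ℝ) (T : (S → ℝ) → EReal) : Prop :=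
  ∀ φ : S → ℝ, φ ∈ B0 K → ∀ k : ℝ, 0 ≤ k → (fun s => φ s + k) ∈ B0 K →
    T φ + (k : EReal) ≤ T (fun s => φ s + k)

theorem add_const_mem_B0 {K : Set ℝ} (hK : Convex ℝ K) (hub : ¬ BddAbove K) {φ : S → ℝ}
    (hφ : φ ∈ B0 K) {k : ℝ} (hk : 0 ≤ k) : (fun s => φ s + k) ∈ B0 K := by
  obtain ⟨hm, hfin, hsub⟩ := hφ
  refine ⟨hm.add_const k, ?_, ?_⟩
  · have h : Set.range (fun s => φ s + k) = (fun x => x + k) '' Set.range φ :=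
      Set.range_comp (fun x => x + k) φ
    rw [h]
    exact hfin.image _
  · rintro _ ⟨s, rfl⟩
    obtain ⟨y, hy, hlt⟩ := not_bddAbove_iff.mp hub (φ s + k)
    exact hK.ordConnected.out (hsub ⟨s, rfl⟩) hy ⟨le_add_of_nonneg_right hk, hlt.le⟩

theorem integrable_of_mem_B0 {K : Set ℝ} {φ : S → ℝ} (hφ : φ ∈ B0 K)
    (p : Measure S) [IsFiniteMeasure p] : Integrable φ p := by
  obtain ⟨C, hC⟩ := hφ.2.1.isBounded.exists_norm_le
  exact Integrable.of_bound hφ.1.aestronglyMeasurable C (ae_of_all _ fun s => hC _ ⟨s, rfl⟩)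

/-- if `K ⊆ ℝ` is convex and unbounded from above and
`T : B₀(Σ,K) → ℝ̄` is constant superadditive, then, for any probability measure `p`,
`t ↦ G_T(t,p)` is constant superadditive: `G_T(t+k,p) ≥ G_T(t,p) + k` for all `t ∈ ℝ`,
`k ≥ 0`. -/
theorem stmt_18 (K : Set ℝ) (hK : Convex ℝ K) (hub : ¬ BddAbove K)
    (T : (S → ℝ) → EReal) (hT : EConstSuperadd K T)
    (p : Measure S) [IsProbabilityMeasure p] :
    ∀ t k : ℝ, 0 ≤ k → GT K T p t + (k : EReal) ≤ GT K T p (t + k) := by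
  intro t k hk
  rw [← EReal.le_sub_iff_add_le (Or.inl (EReal.coe_ne_bot k)) (Or.inl (EReal.coe_ne_top k))]
  refine sSup_le ?_
  rintro _ ⟨φ, hφ, hint, rfl⟩
  rw [EReal.le_sub_iff_add_le (Or.inl (EReal.coe_ne_bot k)) (Or.inl (EReal.coe_ne_top k))]
  have hφk := add_const_mem_B0 hK hub hφ hk
  refine (hT φ hφ k hk hφk).trans (le_sSup ⟨_, hφk, ?_, rfl⟩)
  rw [integral_add (integrable_of_mem_B0 hφ p) (integrable_const k)]
  simpa using hint
end
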